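/- Evolution of the third derivatives of the phase along characteristics (the Ṗ^{(3)} equation of Section 4.3): Let E⁰ : ℝ^d → ℝ be C³, U : ℝ^d → ℝ be C³, T > 0, and let S : [0,T] × ℝ^d → ℝ be a C⁴ solution of ∂_tS(t,x) + E⁰(∇_xS(t,x)) + U(x) = 0. Let Q : [0,T] → ℝ^d be differentiable with Q̇(t) = ∇_pE⁰(∇_xS(t,Q(t))), and set P(t) = ∇_xS(t,Q(t)), M(t) = ∇²_xS(t,Q(t)), and T³(t) = ∇³_xS(t,Q(t)). Then T³ is differentiable and for all t and all indices j,k,l ∈ {1,…,d}: Ṫ³_{jkl}(t) + ∂_{x_j}∂_{x_k}∂_{x_l}U(Q(t)) + Σ_{α,β} [ T³_{αjk}(t) M_{βl}(t) + T³_{αjl}(t) M_{βk}(t) + T³_{αkl}(t) M_{βj}(t) ] ∂_{p_α}∂_{p_β}E⁰(P(t)) + Σ_{α,β,γ} M_{αj}(t) M_{βk}(t) M_{γl}(t) ∂_{p_α}∂_{p_β}∂_{p_γ}E⁰(P(t)) = 0. -/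

import Mathlib

/-- The derivative of `f` in the direction `v`, as a function of the base point. -/
noncomputable def dirDeriv {F : Type*} [NormedAddCommGroup F] [NormedSpace ℝ F] (v : F)
    (f : F → ℝ) : F → ℝ :=
  fun z => fderiv ℝ f z v

section DirDeriv

variable {F : Type*} [NormedAddCommGroup F] [NormedSpace ℝ F]

theorem dirDeriv_eq (v : F) (f : F → ℝ) : dirDeriv v f = fun z => fderiv ℝ f z v :=
  rfl

theorem ContDiff.dirDeriv {f : F → ℝ} {n m : WithTop ℕ∞} (hf : ContDiff ℝ n f)
    (hmn : m + 1 ≤ n) (v : F) : ContDiff ℝ m (dirDeriv v f) :=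
  (hf.fderiv_right hmn).clm_apply contDiff_const

theorem dirDeriv_comm {f : F → ℝ} (hf : ContDiff ℝ 2 f) (v w : F) :
    dirDeriv v (dirDeriv w f) = dirDeriv w (dirDeriv v f) := by
  have second_deriv (v w z : F) :
      dirDeriv v (dirDeriv w f) z = fderiv ℝ (fderiv ℝ f) z v w := by
    have hd : DifferentiableAt ℝ (fderiv ℝ f) z :=
      (hf.fderiv_right (m := 1) (by norm_num)).differentiable (by norm_num) z
    change fderiv ℝ (fun y => fderiv ℝ f y w) z v = _
    rw [fderiv_clm_apply hd (differentiableAt_const w)]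
    simp
  funext z
  rw [second_deriv, second_deriv]
  exact (hf.contDiffAt.isSymmSndFDerivAt (by simp)) v w

theorem dirDeriv_add {f g : F → ℝ} (hf : Differentiable ℝ f) (hg : Differentiable ℝ g) (v : F) :
    dirDeriv v (fun z => f z + g z) = fun z => dirDeriv v f z + dirDeriv v g z := by
  funext z
  simp only [dirDeriv]
  rw [fderiv_fun_add (hf z) (hg z)]
  rfl

theorem dirDeriv_mul {f g : F → ℝ} (hf : Differentiable ℝ f) (hg : Differentiable ℝ g) (v : F) :
    dirDeriv v (fun z => f z * g z) = fun z => dirDeriv v f z * g z + f z * dirDeriv v g z := by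
  funext z
  simp only [dirDeriv]
  rw [fderiv_fun_mul (hf z) (hg z)]
  simp
  ring

theorem dirDeriv_sum {ι : Type*} [Fintype ι] {f : ι → F → ℝ}
    (hf : ∀ i, Differentiable ℝ (f i)) (v : F) :
    dirDeriv v (fun z => ∑ i, f i z) = fun z => ∑ i, dirDeriv v (f i) z := by
  funext z
  simp only [dirDeriv]
  rw [fderiv_fun_sum fun i _ => hf i z]
  simp

theorem fderiv_slice {f : ℝ × F → ℝ} (hf : Differentiable ℝ f) (t : ℝ) (x v : F) :
    fderiv ℝ (fun y => f (t, y)) x v = dirDeriv (0, v) f (t, x) := by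
  have h := (hf (t, x)).hasFDerivAt.comp x (hasFDerivAt_prodMk_right (𝕜 := ℝ) t x)
  rw [HasFDerivAt.fderiv (f := fun y => f (t, y)) h]
  simp [dirDeriv]

theorem dirDeriv_slice_eq_zero {f : ℝ × F → ℝ} (hf : Differentiable ℝ f) {t : ℝ}
    (h : ∀ x, f (t, x) = 0) (v : F) : ∀ x, dirDeriv (0, v) f (t, x) = 0 := by
  intro x
  rw [← fderiv_slice hf]
  simp [h]

theorem dirDeriv_comp_snd {f : F → ℝ} (hf : Differentiable ℝ f) (v : F) :
    dirDeriv ((0 : ℝ), v) (fun z => f z.2) = fun z => dirDeriv v f z.2 := by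
  funext z
  have h := (hf z.2).hasFDerivAt.comp z (hasFDerivAt_snd (𝕜 := ℝ))
  simp only [dirDeriv]
  rw [HasFDerivAt.fderiv (f := fun z : ℝ × F => f z.2) h]
  simp

variable {d : ℕ}

theorem ContinuousLinearMap.apply_eq_sum_single (L : EuclideanSpace ℝ (Fin d) →L[ℝ] ℝ)
    (v : EuclideanSpace ℝ (Fin d)) : L v = ∑ α, v α * L (EuclideanSpace.single α 1) := by
  conv_lhs => rw [← (EuclideanSpace.basisFun (Fin d) ℝ).sum_repr v]
  simp

theorem gradient_apply_eq_fderiv_single (f : EuclideanSpace ℝ (Fin d) → ℝ)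
    (x : EuclideanSpace ℝ (Fin d)) (α : Fin d) :
    gradient f x α = fderiv ℝ f x (EuclideanSpace.single α 1) := by
  have h : inner ℝ (gradient f x) (EuclideanSpace.single α 1)
      = fderiv ℝ f x (EuclideanSpace.single α 1) := by
    simp [gradient]
  rw [← h, EuclideanSpace.inner_single_right]
  simp

theorem dirDeriv_comp {f : EuclideanSpace ℝ (Fin d) → ℝ} {g : F → EuclideanSpace ℝ (Fin d)}
    (hf : Differentiable ℝ f) (hg : Differentiable ℝ g) (v : F) :
    dirDeriv v (fun z => f (g z)) = fun z =>
      ∑ α, dirDeriv (EuclideanSpace.single α 1) f (g z) * dirDeriv v (fun z => g z α) z := by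
  funext z
  have h := (hf (g z)).hasFDerivAt.comp z (hg z).hasFDerivAt
  have hcoord (α : Fin d) : dirDeriv v (fun z => g z α) z = fderiv ℝ g z v α := by
    have := (EuclideanSpace.proj (𝕜 := ℝ) α).hasFDerivAt.comp z (hg z).hasFDerivAt
    simp only [dirDeriv]
    rw [HasFDerivAt.fderiv (f := fun z => g z α) this]
    simp
  simp only [hcoord]
  simp only [dirDeriv]
  rw [HasFDerivAt.fderiv (f := fun z => f (g z)) h, ContinuousLinearMap.comp_apply,
    ContinuousLinearMap.apply_eq_sum_single]
  simp [mul_comm]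

/-- The third-order chain rule (Faà di Bruno formula) in coordinates. -/
theorem dirDeriv_dirDeriv_dirDeriv_comp {f : EuclideanSpace ℝ (Fin d) → ℝ}
    {g : F → EuclideanSpace ℝ (Fin d)} (hf : ContDiff ℝ 3 f) (hg : ContDiff ℝ 3 g)
    (u v w z : F) :
    dirDeriv u (dirDeriv v (dirDeriv w (fun z => f (g z)))) z =
      (∑ α, dirDeriv (EuclideanSpace.single α 1) f (g z) *
        dirDeriv u (dirDeriv v (dirDeriv w (fun z => g z α))) z) +
      (∑ α, ∑ β,
        (dirDeriv u (dirDeriv v (fun z => g z α)) z * dirDeriv w (fun z => g z β) z +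
          dirDeriv u (dirDeriv w (fun z => g z α)) z * dirDeriv v (fun z => g z β) z +
          dirDeriv v (dirDeriv w (fun z => g z α)) z * dirDeriv u (fun z => g z β) z) *
        dirDeriv (EuclideanSpace.single α 1) (dirDeriv (EuclideanSpace.single β 1) f) (g z)) +
      ∑ α, ∑ β, ∑ γ,
        dirDeriv u (fun z => g z α) z * dirDeriv v (fun z => g z β) z *
          dirDeriv w (fun z => g z γ) z *
        dirDeriv (EuclideanSpace.single α 1) (dirDeriv (EuclideanSpace.single β 1)
          (dirDeriv (EuclideanSpace.single γ 1) f)) (g z) := by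
  have hG (α : Fin d) : ContDiff ℝ 3 (fun z => g z α) := contDiff_euclidean.1 hg α
  have hG1 (α : Fin d) (a : F) : ContDiff ℝ 2 (dirDeriv a (fun z => g z α)) :=
    (hG α).dirDeriv (by norm_num) a
  have hG2 (α : Fin d) (a b : F) : ContDiff ℝ 1 (dirDeriv a (dirDeriv b (fun z => g z α))) :=
    (hG1 α b).dirDeriv (by norm_num) a
  have hf1 (α : Fin d) : ContDiff ℝ 2 (dirDeriv (EuclideanSpace.single α 1) f) :=
    hf.dirDeriv (by norm_num) _
  have hf2 (α β : Fin d) : ContDiff ℝ 1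
      (dirDeriv (EuclideanSpace.single α 1) (dirDeriv (EuclideanSpace.single β 1) f)) :=
    (hf1 β).dirDeriv (by norm_num) _
  have dg : Differentiable ℝ g := hg.differentiable (by norm_num)
  have dG1 (α : Fin d) (a : F) := (hG1 α a).differentiable (by norm_num)
  have dG2 (α : Fin d) (a b : F) := (hG2 α a b).differentiable (by norm_num)
  have df1 (α : Fin d) := (hf1 α).differentiable (by norm_num)
  have df2 (α β : Fin d) := (hf2 α β).differentiable (by norm_num)
  have dfg1 (α : Fin d) : Differentiable ℝ
      fun z => dirDeriv (EuclideanSpace.single α 1) f (g z) := (df1 α).comp dg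
  have dfg2 (α β : Fin d) : Differentiable ℝ fun z => dirDeriv (EuclideanSpace.single α 1)
      (dirDeriv (EuclideanSpace.single β 1) f) (g z) := (df2 α β).comp dg
  have first (a : F) := dirDeriv_comp (hf.differentiable (by norm_num)) dg a
  have dfirst (α : Fin d) (a : F) := dirDeriv_comp (df1 α) dg a
  have dsecond (α β : Fin d) (a : F) := dirDeriv_comp (df2 α β) dg a
  have second : dirDeriv v (dirDeriv w (fun z => f (g z))) = fun z => ∑ γ,
      ((∑ β, dirDeriv (EuclideanSpace.single β 1) (dirDeriv (EuclideanSpace.single γ 1) f) (g z) *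
        dirDeriv v (fun z => g z β) z) * dirDeriv w (fun z => g z γ) z +
      dirDeriv (EuclideanSpace.single γ 1) f (g z) *
        dirDeriv v (dirDeriv w (fun z => g z γ)) z) := by
    rw [first, dirDeriv_sum fun γ => (dfg1 γ).fun_mul (dG1 γ w)]
    funext z
    refine Finset.sum_congr rfl fun γ _ => ?_
    rw [dirDeriv_mul (dfg1 γ) (dG1 γ w), dfirst]
  have dsum (γ : Fin d) : Differentiable ℝ fun z => ∑ β, dirDeriv (EuclideanSpace.single β 1)
      (dirDeriv (EuclideanSpace.single γ 1) f) (g z) * dirDeriv v (fun z => g z β) z :=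
    Differentiable.fun_sum fun β _ => (dfg2 β γ).fun_mul (dG1 β v)
  have third : dirDeriv u (dirDeriv v (dirDeriv w (fun z => f (g z)))) z = ∑ γ,
      ((∑ β, ((∑ α, dirDeriv (EuclideanSpace.single α 1) (dirDeriv (EuclideanSpace.single β 1)
              (dirDeriv (EuclideanSpace.single γ 1) f)) (g z) *
            dirDeriv u (fun z => g z α) z) * dirDeriv v (fun z => g z β) z +
          dirDeriv (EuclideanSpace.single β 1) (dirDeriv (EuclideanSpace.single γ 1) f) (g z) *
            dirDeriv u (dirDeriv v (fun z => g z β)) z)) * dirDeriv w (fun z => g z γ) z +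
        (∑ β, dirDeriv (EuclideanSpace.single β 1)
            (dirDeriv (EuclideanSpace.single γ 1) f) (g z) * dirDeriv v (fun z => g z β) z) *
          dirDeriv u (dirDeriv w (fun z => g z γ)) z +
        ((∑ β, dirDeriv (EuclideanSpace.single β 1)
            (dirDeriv (EuclideanSpace.single γ 1) f) (g z) * dirDeriv u (fun z => g z β) z) *
          dirDeriv v (dirDeriv w (fun z => g z γ)) z +
        dirDeriv (EuclideanSpace.single γ 1) f (g z) *
          dirDeriv u (dirDeriv v (dirDeriv w (fun z => g z γ))) z)) := by
    rw [second, dirDeriv_sum fun γ =>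
      ((dsum γ).fun_mul (dG1 γ w)).fun_add ((dfg1 γ).fun_mul (dG2 γ v w))]
    refine Finset.sum_congr rfl fun γ _ => ?_
    rw [dirDeriv_add ((dsum γ).fun_mul (dG1 γ w)) ((dfg1 γ).fun_mul (dG2 γ v w)),
      dirDeriv_mul (dsum γ) (dG1 γ w), dirDeriv_mul (dfg1 γ) (dG2 γ v w),
      dirDeriv_sum fun β => (dfg2 β γ).fun_mul (dG1 β v), dfirst]
    simp only [dirDeriv_mul (dfg2 _ γ) (dG1 _ v), dsecond]
  have symm (α β : Fin d) := congrFun (dirDeriv_comm (hf.of_le (by norm_num))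
    (EuclideanSpace.single α (1 : ℝ)) (EuclideanSpace.single β 1)) (g z)
  rw [third]
  simp only [Finset.sum_add_distrib, add_mul, Finset.sum_mul]
  have cubic : ∑ γ, ∑ β, ∑ α, dirDeriv (EuclideanSpace.single α 1)
        (dirDeriv (EuclideanSpace.single β 1) (dirDeriv (EuclideanSpace.single γ 1) f)) (g z) *
          dirDeriv u (fun z => g z α) z * dirDeriv v (fun z => g z β) z *
          dirDeriv w (fun z => g z γ) z =
      ∑ α, ∑ β, ∑ γ, dirDeriv u (fun z => g z α) z * dirDeriv v (fun z => g z β) z *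
          dirDeriv w (fun z => g z γ) z * dirDeriv (EuclideanSpace.single α 1)
        (dirDeriv (EuclideanSpace.single β 1) (dirDeriv (EuclideanSpace.single γ 1) f)) (g z) := by
    rw [Finset.sum_comm]
    refine (Finset.sum_congr rfl fun β _ => Finset.sum_comm).trans ?_
    rw [Finset.sum_comm]
    exact Finset.sum_congr rfl fun α _ => Finset.sum_congr rfl fun β _ =>
      Finset.sum_congr rfl fun γ _ => by ring
  have quadratic : ∑ γ, ∑ β, dirDeriv (EuclideanSpace.single β 1)
        (dirDeriv (EuclideanSpace.single γ 1) f) (g z) *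
          dirDeriv u (dirDeriv v (fun z => g z β)) z * dirDeriv w (fun z => g z γ) z =
      ∑ α, ∑ β, dirDeriv u (dirDeriv v (fun z => g z α)) z * dirDeriv w (fun z => g z β) z *
        dirDeriv (EuclideanSpace.single α 1) (dirDeriv (EuclideanSpace.single β 1) f) (g z) := by
    rw [Finset.sum_comm]
    exact Finset.sum_congr rfl fun α _ => Finset.sum_congr rfl fun β _ => by ring
  have quadratic_symm (a b c : F) : ∑ γ, ∑ β, dirDeriv (EuclideanSpace.single β 1)
        (dirDeriv (EuclideanSpace.single γ 1) f) (g z) *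
          dirDeriv a (fun z => g z β) z * dirDeriv b (dirDeriv c (fun z => g z γ)) z =
      ∑ α, ∑ β, dirDeriv b (dirDeriv c (fun z => g z α)) z * dirDeriv a (fun z => g z β) z *
        dirDeriv (EuclideanSpace.single α 1) (dirDeriv (EuclideanSpace.single β 1) f) (g z) :=
    Finset.sum_congr rfl fun α _ => Finset.sum_congr rfl fun β _ => by rw [symm]; ring
  rw [cubic, quadratic, quadratic_symm, quadratic_symm]
  ring

end DirDeriv


/-- Evolution of the third derivatives of the phase along characteristics (the `Ṗ⁽³⁾`
equation of Section 4.3): along the characteristics `Q̇ = ∇_p E⁰(∇_x S(t,Q))` of the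
leading-order Hamilton–Jacobi equation `∂_t S + E⁰(∇_x S) + U = 0`, the third
derivatives `T³(t) = ∇³_x S(t, Q(t))` satisfy
`Ṫ³_{jkl} + ∂_{x_j}∂_{x_k}∂_{x_l}U(Q)
 + Σ_{α,β} [T³_{αjk} M_{βl} + T³_{αjl} M_{βk} + T³_{αkl} M_{βj}] ∂_{p_α}∂_{p_β}E⁰(P)
 + Σ_{α,β,γ} M_{αj} M_{βk} M_{γl} ∂_{p_α}∂_{p_β}∂_{p_γ}E⁰(P) = 0`. -/
theorem third_derivatives_phase_along_characteristics
    {d : ℕ}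
    (E0 : EuclideanSpace ℝ (Fin d) → ℝ) (hE0 : ContDiff ℝ 3 E0)
    (U : EuclideanSpace ℝ (Fin d) → ℝ) (hU : ContDiff ℝ 3 U)
    (T : ℝ) (hT : 0 < T)
    (S : ℝ × EuclideanSpace ℝ (Fin d) → ℝ) (hS : ContDiff ℝ 4 S)
    (hHJ : ∀ t ∈ Set.Icc (0 : ℝ) T, ∀ x,
      fderiv ℝ S (t, x) (1, 0) + E0 (gradient (fun y => S (t, y)) x) + U x = 0)
    (Q : ℝ → EuclideanSpace ℝ (Fin d))
    (hQ : ∀ t ∈ Set.Icc (0 : ℝ) T,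
      HasDerivWithinAt Q (gradient E0 (gradient (fun y => S (t, y)) (Q t)))
        (Set.Icc (0 : ℝ) T) t)
    (P : ℝ → EuclideanSpace ℝ (Fin d))
    (hP : P = fun t => gradient (fun y => S (t, y)) (Q t))
    (M : ℝ → Fin d → Fin d → ℝ)
    (hM : M = fun t j k =>
      fderiv ℝ (fun y => fderiv ℝ (fun y' => S (t, y')) y (EuclideanSpace.single k 1))
        (Q t) (EuclideanSpace.single j 1))
    (T3 : ℝ → Fin d → Fin d → Fin d → ℝ)
    (hT3 : T3 = fun t j k l =>
      fderiv ℝ (fun y => fderiv ℝ (fun y' => fderiv ℝ (fun y'' => S (t, y''))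
          y' (EuclideanSpace.single l 1)) y (EuclideanSpace.single k 1))
        (Q t) (EuclideanSpace.single j 1)) :
    ∀ t ∈ Set.Icc (0 : ℝ) T, ∀ j k l : Fin d,
      HasDerivWithinAt (fun s => T3 s j k l)
        (-(fderiv ℝ (fun y => fderiv ℝ (fun y' => fderiv ℝ U y'
              (EuclideanSpace.single l 1)) y (EuclideanSpace.single k 1)) (Q t)
            (EuclideanSpace.single j 1)
          + (∑ α : Fin d, ∑ β : Fin d,
              (T3 t α j k * M t β l + T3 t α j l * M t β k + T3 t α k l * M t β j) *
                fderiv ℝ (fun q => fderiv ℝ E0 q (EuclideanSpace.single β 1)) (P t)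
                  (EuclideanSpace.single α 1))
          + (∑ α : Fin d, ∑ β : Fin d, ∑ γ : Fin d,
              M t α j * M t β k * M t γ l *
                fderiv ℝ (fun q => fderiv ℝ (fun q' => fderiv ℝ E0 q'
                    (EuclideanSpace.single γ 1)) q (EuclideanSpace.single β 1)) (P t)
                  (EuclideanSpace.single α 1))))
        (Set.Icc (0 : ℝ) T) t := by
  intro t ht j k l
  let e : Fin d → ℝ × EuclideanSpace ℝ (Fin d) := fun α => (0, EuclideanSpace.single α 1)
  let τ : ℝ × EuclideanSpace ℝ (Fin d) := (1, 0)
  have hS1 (a) : ContDiff ℝ 3 (dirDeriv a S) := hS.dirDeriv (by norm_num) a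
  have hS2 (a b) : ContDiff ℝ 2 (dirDeriv a (dirDeriv b S)) := (hS1 b).dirDeriv (by norm_num) a
  have hS3 (a b c) : ContDiff ℝ 1 (dirDeriv a (dirDeriv b (dirDeriv c S))) :=
    (hS2 b c).dirDeriv (by norm_num) a
  have dS : Differentiable ℝ S := hS.differentiable (by norm_num)
  have dS1 (a) := (hS1 a).differentiable (by norm_num)
  have dS2 (a b) := (hS2 a b).differentiable (by norm_num)
  have dS3 (a b c) := (hS3 a b c).differentiable (by norm_num)
  have comm1 (a b) : dirDeriv a (dirDeriv b S) = dirDeriv b (dirDeriv a S) :=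
    dirDeriv_comm (hS.of_le (by norm_num)) a b
  have comm2 (a b c) : dirDeriv a (dirDeriv b (dirDeriv c S)) =
      dirDeriv b (dirDeriv a (dirDeriv c S)) :=
    dirDeriv_comm ((hS1 c).of_le (by norm_num)) a b
  have comm3 (a b c c') : dirDeriv a (dirDeriv b (dirDeriv c (dirDeriv c' S))) =
      dirDeriv b (dirDeriv a (dirDeriv c (dirDeriv c' S))) :=
    dirDeriv_comm (hS2 c c') a b
  have rot (a b c c') : dirDeriv a (dirDeriv b (dirDeriv c (dirDeriv c' S))) =
      dirDeriv c' (dirDeriv a (dirDeriv b (dirDeriv c S))) := by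
    rw [comm1 c c', comm2 b c', comm3 a c']
  let g : ℝ × EuclideanSpace ℝ (Fin d) → EuclideanSpace ℝ (Fin d) :=
    fun z => gradient (fun y => S (z.1, y)) z.2
  have hgS (α : Fin d) : (fun z => g z α) = dirDeriv (e α) S := by
    funext z
    exact (gradient_apply_eq_fderiv_single _ _ _).trans (fderiv_slice dS _ _ _)
  have hg : ContDiff ℝ 3 g := contDiff_euclidean.2 fun α => by
    rw [hgS]
    exact hS1 _
  have hE0g : ContDiff ℝ 3 fun z => E0 (g z) := hE0.comp hg
  have hUsnd : ContDiff ℝ 3 fun z : ℝ × EuclideanSpace ℝ (Fin d) => U z.2 := hU.comp contDiff_snd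
  have hsum : dirDeriv (e j) (dirDeriv (e k) (dirDeriv (e l)
      fun z => dirDeriv τ S z + E0 (g z) + U z.2)) (t, Q t) = 0 := by
    have h0 : ContDiff ℝ 3 fun z => dirDeriv τ S z + E0 (g z) + U z.2 :=
      ((hS1 τ).add hE0g).add hUsnd
    have h1 := h0.dirDeriv (m := 2) (by norm_num) (e l)
    have h2 := h1.dirDeriv (m := 1) (by norm_num) (e k)
    exact dirDeriv_slice_eq_zero (h2.differentiable (by norm_num))
      (dirDeriv_slice_eq_zero (h1.differentiable (by norm_num))
        (dirDeriv_slice_eq_zero (h0.differentiable (by norm_num)) (hHJ t ht) _) _) _ _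
  have add3 {f₁ f₂ : ℝ × EuclideanSpace ℝ (Fin d) → ℝ} (h₁ : ContDiff ℝ 3 f₁)
      (h₂ : ContDiff ℝ 3 f₂) (a b c) : dirDeriv a (dirDeriv b (dirDeriv c
        fun z => f₁ z + f₂ z)) = fun z => dirDeriv a (dirDeriv b (dirDeriv c f₁)) z +
          dirDeriv a (dirDeriv b (dirDeriv c f₂)) z := by
    have h₁' := h₁.dirDeriv (m := 2) (by norm_num) c
    have h₂' := h₂.dirDeriv (m := 2) (by norm_num) c
    rw [dirDeriv_add (h₁.differentiable (by norm_num)) (h₂.differentiable (by norm_num)),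
      dirDeriv_add (h₁'.differentiable (by norm_num)) (h₂'.differentiable (by norm_num)),
      dirDeriv_add ((h₁'.dirDeriv (m := 1) (by norm_num) b).differentiable (by norm_num))
        ((h₂'.dirDeriv (m := 1) (by norm_num) b).differentiable (by norm_num))]
  have hU1 := hU.dirDeriv (m := 2) (by norm_num) (EuclideanSpace.single l 1)
  have hU2 := hU1.dirDeriv (m := 1) (by norm_num) (EuclideanSpace.single k 1)
  have hUd : dirDeriv (e j) (dirDeriv (e k) (dirDeriv (e l)
      fun z : ℝ × EuclideanSpace ℝ (Fin d) => U z.2)) (t, Q t) =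
      dirDeriv (EuclideanSpace.single j 1) (dirDeriv (EuclideanSpace.single k 1)
        (dirDeriv (EuclideanSpace.single l 1) U)) (Q t) := by
    rw [dirDeriv_comp_snd (hU.differentiable (by norm_num)),
      dirDeriv_comp_snd (hU1.differentiable (by norm_num)),
      dirDeriv_comp_snd (hU2.differentiable (by norm_num))]
  rw [add3 ((hS1 τ).add hE0g) hUsnd, add3 (hS1 τ) hE0g] at hsum
  beta_reduce at hsum
  rw [hUd, dirDeriv_dirDeriv_dirDeriv_comp hE0 hg] at hsum
  simp only [hgS] at hsum
  have hM' (s : ℝ) (α β : Fin d) : M s α β = dirDeriv (e α) (dirDeriv (e β) S) (s, Q s) := by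
    simp only [hM, fderiv_slice dS]
    exact fderiv_slice (dS1 _) _ _ _
  have hT3' (s : ℝ) (α β γ : Fin d) :
      T3 s α β γ = dirDeriv (e α) (dirDeriv (e β) (dirDeriv (e γ) S)) (s, Q s) := by
    simp only [hT3, fderiv_slice dS]
    have h := fun y => fderiv_slice (dS1 (e γ)) s y (EuclideanSpace.single β 1)
    simp only [e] at h
    simp only [h]
    exact fderiv_slice (dS2 _ _) _ _ _
  have hcurve : HasDerivWithinAt (fun s => (s, Q s)) (1, gradient E0 (P t)) (Set.Icc 0 T) t := by
    have h := (hasDerivWithinAt_id t (Set.Icc 0 T)).prodMk (hQ t ht)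
    rw [hP]
    exact h
  have hT3deriv := (dS3 (e j) (e k) (e l) (t, Q t)).hasFDerivAt.comp_hasDerivWithinAt t hcurve
  have hvalue : fderiv ℝ (dirDeriv (e j) (dirDeriv (e k) (dirDeriv (e l) S))) (t, Q t)
      (1, gradient E0 (P t)) =
      dirDeriv τ (dirDeriv (e j) (dirDeriv (e k) (dirDeriv (e l) S))) (t, Q t) +
      ∑ α, dirDeriv (EuclideanSpace.single α 1) E0 (P t) *
        dirDeriv (e α) (dirDeriv (e j) (dirDeriv (e k) (dirDeriv (e l) S))) (t, Q t) := by
    have hsplit : ((1 : ℝ), gradient E0 (P t)) = τ + (0, gradient E0 (P t)) := by simp [τ]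
    rw [hsplit, map_add]
    congr 1
    have h := ContinuousLinearMap.apply_eq_sum_single
      ((fderiv ℝ (dirDeriv (e j) (dirDeriv (e k) (dirDeriv (e l) S))) (t, Q t)).comp
        (ContinuousLinearMap.inr ℝ ℝ (EuclideanSpace ℝ (Fin d)))) (gradient E0 (P t))
    simp only [gradient_apply_eq_fderiv_single] at h
    exact h
  have hPt : P t = g (t, Q t) := by rw [hP]
  rw [hvalue] at hT3deriv
  have hT3eq : (fun s => T3 s j k l) =
      dirDeriv (e j) (dirDeriv (e k) (dirDeriv (e l) S)) ∘ fun s => (s, Q s) :=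
    funext fun s => hT3' s j k l
  have hthird (α β γ : Fin d) :
      dirDeriv (e β) (dirDeriv (e γ) (dirDeriv (e α) S)) (t, Q t) = T3 t α β γ := by
    rw [hT3', comm1 (e γ), comm2 (e β)]
  have hsecond (α β : Fin d) : dirDeriv (e β) (dirDeriv (e α) S) (t, Q t) = M t α β := by
    rw [hM', comm1]
  simp only [rot (e j) (e k) (e l) τ, fun α => rot (e j) (e k) (e l) (e α), ← hPt, hthird,
    hsecond] at hsum
  rw [hT3eq]
  refine hT3deriv.congr_deriv ?_
  simp only [dirDeriv_eq] at hsum ⊢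
  linarith
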